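/- Let n ≥ 2 be an integer and let f be a bounded continuous function on [0,∞) with f ∈ W²_0(ψ) and D̃f ∈ W²(ψ). Then for every x ∈ [0,∞), Ṽ_n(f,x) − f(x) = −Σ_{k=n}^∞ (1/(k(k+1)²))·V_k(D̃²f, x). -/

import Mathlib

open MeasureTheory Filter Set

/-- Baskakov basis functions `P_{n,k}(x)`, with `P_{n,k} := 0` for `k < 0`. -/
noncomputable def P (n : ℕ) (k : ℤ) (x : ℝ) : ℝ :=
  if k < 0 then 0
  else (Nat.choose (n + k.toNat - 1) k.toNat : ℝ) * x ^ k.toNat * (1 + x) ^ (-(n : ℤ) - k)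

/-- The weight `ψ(x) = x(1+x)`. -/
noncomputable def psi (x : ℝ) : ℝ := x * (1 + x)

/-- The differential operator `D̃ f = ψ f''`. -/
noncomputable def Dt (f : ℝ → ℝ) : ℝ → ℝ := fun x => psi x * deriv (deriv f) x

/-- The functionals `v_{n,k}`. -/
noncomputable def v (n k : ℕ) (f : ℝ → ℝ) : ℝ :=
  if k = 0 then f 0
  else ((n : ℝ) + 1) * ∫ t in Set.Ioi (0 : ℝ), P (n + 2) ((k : ℤ) - 1) t * f t

/-- The Goodman–Sharma–Baskakov operator `V_n`. -/
noncomputable def V (n : ℕ) (f : ℝ → ℝ) (x : ℝ) : ℝ :=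
  ∑' k : ℕ, v n k f * P n (k : ℤ) x

/-- The modified operator `Ṽ_n`. -/
noncomputable def Vt (n : ℕ) (f : ℝ → ℝ) (x : ℝ) : ℝ :=
  ∑' k : ℕ, v n k f * (P n (k : ℤ) x - (1 / (n : ℝ)) * Dt (P n (k : ℤ)) x)

/-- Supremum norm on `[0,∞)`. -/
noncomputable def supNorm (f : ℝ → ℝ) : ℝ := ⨆ x ∈ Set.Ici (0 : ℝ), |f x|

/-- `f` is bounded and continuous on `[0,∞)`. -/
def BddContOn (f : ℝ → ℝ) : Prop :=
  ContinuousOn f (Set.Ici 0) ∧ ∃ M, ∀ x ∈ Set.Ici (0 : ℝ), |f x| ≤ M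

/-- The space `W²(ψ)`: `g, g'` (locally) differentiable on `(0,∞)` and `D̃ g` bounded. -/
def MemW2 (g : ℝ → ℝ) : Prop :=
  DifferentiableOn ℝ g (Set.Ioi 0) ∧ DifferentiableOn ℝ (deriv g) (Set.Ioi 0) ∧
    ∃ M, ∀ x ∈ Set.Ioi (0 : ℝ), |Dt g x| ≤ M

/-- The space `W²₀(ψ)`: members of `W²(ψ)` with `D̃ g(x) → 0` as `x → 0⁺`. -/
def MemW20 (g : ℝ → ℝ) : Prop :=
  MemW2 g ∧ Filter.Tendsto (Dt g) (nhdsWithin 0 (Set.Ioi 0)) (nhds 0)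

/-- The K-functional `K(f,t)`. -/
noncomputable def Kfun (f : ℝ → ℝ) (t : ℝ) : ℝ :=
  sInf {a : ℝ | ∃ g : ℝ → ℝ, MemW20 g ∧ MemW2 (Dt g) ∧
    a = supNorm (fun x => f x - g x) + t * supNorm (Dt (Dt g))}

/-- The function `T_{n,k}(x)`. -/
noncomputable def T (n : ℕ) (k : ℤ) (x : ℝ) : ℝ :=
  (k : ℝ) * ((k : ℝ) - 1) * (1 + x) / x - 2 * (k : ℝ) * ((n : ℝ) + (k : ℝ))
    + ((n : ℝ) + (k : ℝ)) * ((n : ℝ) + (k : ℝ) + 1) * x / (1 + x)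
theorem P_of_neg (n : ℕ) {k : ℤ} (hk : k < 0) (x : ℝ) : P n k x = 0 := by
  simp [P, hk]

theorem P_natCast (n k : ℕ) (x : ℝ) :
    P n (k : ℤ) x = ((n + k - 1).choose k : ℝ) * x ^ k * ((1 + x) ^ (n + k))⁻¹ := by
  have h : (-(n : ℤ) - k) = -((n + k : ℕ) : ℤ) := by push_cast; ring
  rw [P, if_neg (by omega), h, zpow_neg, zpow_natCast, Int.toNat_natCast]

theorem P_nonneg (n : ℕ) (k : ℤ) {x : ℝ} (hx : 0 ≤ x) : 0 ≤ P n k x := by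
  unfold P
  split_ifs
  · rfl
  · positivity

theorem add_one_mul_choose (n k : ℕ) :
    ((k : ℝ) + 1) * ((n + k).choose (k + 1) : ℝ) = n * ((n + k).choose k : ℝ) := by
  have h := Nat.choose_succ_right_eq (n + k) k
  rw [Nat.add_sub_cancel] at h
  have h' : (((n + k).choose (k + 1) * (k + 1) : ℕ) : ℝ) = (((n + k).choose k * n : ℕ) : ℝ) := by
    rw [h]
  push_cast at h'
  linarith

theorem add_mul_choose (n k : ℕ) (hn : 1 ≤ n) :
    ((n : ℝ) + k) * ((n + k - 1).choose k : ℝ) = n * ((n + k).choose k : ℝ) := by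
  obtain ⟨m, rfl⟩ := Nat.exists_eq_add_of_le' hn
  have h := Nat.choose_mul_succ_eq (m + k) k
  have e : m + 1 + k - 1 = m + k := by omega
  have e2 : m + 1 + k = m + k + 1 := by omega
  have e3 : m + k + 1 - k = m + 1 := by omega
  rw [e3] at h
  rw [e, e2]
  have h' : (((m + k).choose k * (m + k + 1) : ℕ) : ℝ)
    = (((m + k + 1).choose k * (m + 1) : ℕ) : ℝ) := by rw [h]
  push_cast at h' ⊢
  linarith

/-- `k P_{n,k}(x) = n x P_{n+1,k-1}(x)`. -/
theorem mul_P_eq (n : ℕ) (hn : 1 ≤ n) (k : ℤ) (x : ℝ) :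
    (k : ℝ) * P n k x = n * x * P (n + 1) (k - 1) x := by
  rcases lt_or_ge k 0 with hk | hk
  · rw [P_of_neg n hk, P_of_neg (n + 1) (by omega)]; simp
  lift k to ℕ using hk
  cases k with
  | zero => rw [P_of_neg (n + 1) (by simp)]; simp
  | succ j =>
    have e : (((j + 1 : ℕ) : ℤ) - 1) = (j : ℤ) := by push_cast; ring
    rw [e, P_natCast, P_natCast]
    have h := add_one_mul_choose n j
    have e1 : n + (j + 1) - 1 = n + j := by omega
    have e2 : n + 1 + j - 1 = n + j := by omega
    have e3 : n + 1 + j = n + (j + 1) := by omega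
    rw [e1, e2, e3]
    push_cast
    linear_combination x ^ (j + 1) * ((1 + x) ^ (n + (j + 1)))⁻¹ * h

/-- `(n + k) P_{n,k}(x) = n (1 + x) P_{n+1,k}(x)`. -/
theorem add_mul_P_eq (n : ℕ) (hn : 1 ≤ n) (k : ℤ) {x : ℝ} (hx : 0 ≤ x) :
    ((n : ℝ) + k) * P n k x = n * (1 + x) * P (n + 1) k x := by
  rcases lt_or_ge k 0 with hk | hk
  · rw [P_of_neg n hk, P_of_neg (n + 1) hk]; simp
  lift k to ℕ using hk
  rw [P_natCast, P_natCast]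
  have h := add_mul_choose n k hn
  have hx' : (1 + x) ≠ 0 := by positivity
  have e2 : n + 1 + k - 1 = n + k := by omega
  have e3 : n + 1 + k = n + k + 1 := by omega
  rw [e2, e3, pow_succ]
  field_simp
  push_cast
  linear_combination x ^ k * h

theorem hasDerivAt_P (n : ℕ) (hn : 1 ≤ n) (k : ℤ) {x : ℝ} (hx : 0 ≤ x) :
    HasDerivAt (P n k) (n * (P (n + 1) (k - 1) x - P (n + 1) k x)) x := by
  rcases lt_or_ge k 0 with hk | hk
  · have : P n k = fun _ => 0 := funext (P_of_neg n hk)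
    rw [P_of_neg (n + 1) hk, P_of_neg (n + 1) (by omega), this]
    simpa using hasDerivAt_const x (0 : ℝ)
  lift k to ℕ using hk
  have hx' : (1 + x) ≠ 0 := by positivity
  have hP : P n (k : ℤ) =
      fun x => ((n + k - 1).choose k : ℝ) * x ^ k * ((1 + x) ^ (n + k))⁻¹ :=
    funext (P_natCast n k)
  have h1 : HasDerivAt (fun x : ℝ => (1 + x) ^ (n + k))
      (((n + k : ℕ) : ℝ) * (1 + x) ^ (n + k - 1) * 1) x :=
    ((hasDerivAt_id x).const_add 1).pow (n + k)
  have h2 := ((hasDerivAt_pow k x).const_mul ((n + k - 1).choose k : ℝ)).mul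
    (h1.inv (pow_ne_zero _ hx'))
  have h3 := mul_P_eq n hn k x
  have h4 := add_mul_P_eq n hn k hx
  rw [hP]
  refine h2.congr_deriv ?_
  obtain ⟨m, hm⟩ : ∃ m, n + k = m + 1 := ⟨n + k - 1, by omega⟩
  have h5 : (n : ℝ) * P (n + 1) k x
      = ((n : ℝ) + k) * (((n + k - 1).choose k : ℝ) * x ^ k * ((1 + x) ^ (n + k + 1))⁻¹) := by
    rw [P_natCast] at h4
    have : (n : ℝ) * P (n + 1) k x = (((n : ℝ) + k) *
      (((n + k - 1).choose k : ℝ) * x ^ k * ((1 + x) ^ (n + k))⁻¹)) * (1 + x)⁻¹ := by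
      push_cast at h4
      rw [h4]; field_simp
    rw [this, pow_succ]
    field_simp
  have h6 : (n : ℝ) * P (n + 1) (k - 1) x
      = k * (((n + k - 1).choose k : ℝ) * x ^ (k - 1) * ((1 + x) ^ (n + k))⁻¹) := by
    cases k with
    | zero => rw [P_of_neg (n + 1) (by simp)]; simp
    | succ j =>
      have e : (((j + 1 : ℕ) : ℤ) - 1) = (j : ℤ) := by push_cast; ring
      have h := add_one_mul_choose n j
      have e1 : n + (j + 1) - 1 = n + j := by omega
      have e2 : n + 1 + j - 1 = n + j := by omega
      have e3 : n + 1 + j = n + (j + 1) := by omega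
      rw [e, P_natCast, e1, e2, e3, Nat.add_sub_cancel]
      push_cast
      linear_combination -x ^ j * ((1 + x) ^ (n + (j + 1)))⁻¹ * h
  rw [mul_sub, h5, h6]
  have hc : ((n + k : ℕ) : ℝ) = (n : ℝ) + k := by push_cast; ring
  have e7 : (1 + x) ^ (n + k - 1) * ((1 + x) ^ (n + k) * (1 + x) ^ (n + k))⁻¹
      = ((1 + x) ^ (n + k + 1))⁻¹ := by
    rw [hm, Nat.add_sub_cancel]
    field_simp
    ring
  rw [hc, pow_two, div_eq_mul_inv, Pi.inv_apply]
  linear_combination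
    -((n + k - 1).choose k : ℝ) * x ^ k * ((n : ℝ) + k) * e7

theorem continuousOn_P (n : ℕ) (hn : 1 ≤ n) (k : ℤ) : ContinuousOn (P n k) (Ici 0) :=
  fun _ hx => (hasDerivAt_P n hn k hx).continuousAt.continuousWithinAt

/-- The second derivative of `P_{n,k}`. -/
theorem hasDerivAt_deriv_P (n : ℕ) (hn : 1 ≤ n) (k : ℤ) {x : ℝ} (hx : 0 ≤ x) :
    HasDerivAt (fun t => (n : ℝ) * (P (n + 1) (k - 1) t - P (n + 1) k t))
      (n * (n + 1) * (P (n + 2) (k - 2) x - 2 * P (n + 2) (k - 1) x + P (n + 2) k x)) x := by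
  have h1 := hasDerivAt_P (n + 1) (by omega) (k - 1) hx
  have h2 := hasDerivAt_P (n + 1) (by omega) k hx
  refine ((h1.sub h2).const_mul (n : ℝ)).congr_deriv ?_
  have e : k - 1 - 1 = k - 2 := by ring
  rw [e]
  push_cast
  ring

/-- `n (n + 1) ψ P_{n+2,k-1} = k (n + k) P_{n,k}`. -/
theorem psi_mul_P (n : ℕ) (hn : 1 ≤ n) (k : ℤ) {x : ℝ} (hx : 0 ≤ x) :
    n * (n + 1) * (psi x * P (n + 2) (k - 1) x) = k * ((n : ℝ) + k) * P n k x := by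
  have h1 := mul_P_eq n hn k x
  have h2 := add_mul_P_eq (n + 1) (by omega) (k - 1) hx
  push_cast at h2
  unfold psi
  linear_combination (-(n : ℝ) * x) * h2 - ((n : ℝ) + k) * h1

theorem Dt_P (n : ℕ) (hn : 1 ≤ n) (k : ℤ) {x : ℝ} (hx : 0 ≤ x) :
    Dt (P n k) x = ((k : ℝ) - 1) * (n + k - 1) * P n (k - 1) x - 2 * (k * (n + k) * P n k x)
      + ((k : ℝ) + 1) * (n + k + 1) * P n (k + 1) x := by
  rcases hx.eq_or_lt with rfl | hx0
  · have h1 := psi_mul_P n hn (k - 1) le_rfl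
    have h2 := psi_mul_P n hn k le_rfl
    have h3 := psi_mul_P n hn (k + 1) le_rfl
    simp only [psi, zero_mul, mul_zero] at h1 h2 h3
    push_cast at h1 h2 h3
    simp only [Dt, psi, zero_mul]
    linear_combination h1 - 2 * h2 + h3
  have hev : deriv (P n k) =ᶠ[nhds x]
      fun t => (n : ℝ) * (P (n + 1) (k - 1) t - P (n + 1) k t) := by
    filter_upwards [Ioi_mem_nhds hx0] with t ht
    exact (hasDerivAt_P n hn k (le_of_lt ht)).deriv
  have h1 := psi_mul_P n hn (k - 1) hx
  have h2 := psi_mul_P n hn k hx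
  have h3 := psi_mul_P n hn (k + 1) hx
  have e1 : k - 1 - 1 = k - 2 := by ring
  have e2 : k + 1 - 1 = k := by ring
  rw [e1] at h1
  rw [e2] at h3
  push_cast at h1 h2 h3
  rw [Dt, hev.deriv_eq, (hasDerivAt_deriv_P n hn k hx).deriv]
  linear_combination h1 - 2 * h2 + h3

theorem exists_P_le (n : ℕ) (k : ℤ) :
    ∃ C, 0 ≤ C ∧ ∀ t, 0 ≤ t → P n k t ≤ C * ((1 + t) ^ n)⁻¹ := by
  rcases lt_or_ge k 0 with hk | hk
  · exact ⟨0, le_rfl, fun t _ => by simp [P_of_neg n hk]⟩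
  lift k to ℕ using hk
  refine ⟨(n + k - 1).choose k, by positivity, fun t ht => ?_⟩
  have h1 : (1 + t) ≠ 0 := by positivity
  have h2 : t ^ k ≤ (1 + t) ^ k := pow_le_pow_left₀ ht (by linarith) k
  rw [P_natCast, mul_assoc, pow_add, mul_inv]
  gcongr
  calc t ^ k * (((1 + t) ^ n)⁻¹ * ((1 + t) ^ k)⁻¹)
      ≤ (1 + t) ^ k * (((1 + t) ^ n)⁻¹ * ((1 + t) ^ k)⁻¹) := by gcongr
    _ = ((1 + t) ^ n)⁻¹ := by field_simp

theorem tendsto_inv_one_add_pow (n : ℕ) (hn : 1 ≤ n) :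
    Tendsto (fun t : ℝ => ((1 + t) ^ n)⁻¹) atTop (nhds 0) :=
  ((tendsto_pow_atTop (by omega)).comp (tendsto_atTop_add_const_left _ 1 tendsto_id)).inv_tendsto_atTop

theorem tendsto_P_atTop (n : ℕ) (hn : 1 ≤ n) (k : ℤ) : Tendsto (P n k) atTop (nhds 0) := by
  obtain ⟨C, _, hC⟩ := exists_P_le n k
  have h := (tendsto_inv_one_add_pow n hn).const_mul C
  rw [mul_zero] at h
  refine tendsto_of_tendsto_of_tendsto_of_le_of_le' tendsto_const_nhds h ?_ ?_
  · filter_upwards [eventually_ge_atTop 0] with t ht using P_nonneg n k ht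
  · filter_upwards [eventually_ge_atTop 0] with t ht using hC t ht

theorem hasDerivAt_neg_inv_one_add_pow (m : ℕ) {t : ℝ} (ht : 0 ≤ t) :
    HasDerivAt (fun t : ℝ => -((1 + t) ^ (m + 1))⁻¹) ((m + 1) * ((1 + t) ^ (m + 2))⁻¹) t := by
  have h0 : (1 + t) ≠ 0 := by positivity
  have h1 : HasDerivAt (fun x : ℝ => (1 + x) ^ (m + 1)) (((m + 1 : ℕ) : ℝ) * (1 + t) ^ m * 1) t :=
    ((hasDerivAt_id t).const_add 1).pow (m + 1)
  refine (h1.inv (pow_ne_zero _ h0)).neg.congr_deriv ?_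
  push_cast
  field_simp
  ring

theorem integrableOn_inv_one_add_pow (n : ℕ) (hn : 2 ≤ n) :
    IntegrableOn (fun t : ℝ => ((1 + t) ^ n)⁻¹) (Ioi 0) := by
  obtain ⟨m, rfl⟩ := Nat.exists_eq_add_of_le' hn
  have h := integrableOn_Ioi_deriv_of_nonneg'
    (fun t (ht : t ∈ Ici (0 : ℝ)) => hasDerivAt_neg_inv_one_add_pow m ht)
    (fun t (ht : t ∈ Ioi (0 : ℝ)) => by
      have : (0 : ℝ) < t := ht
      positivity) (tendsto_inv_one_add_pow (m + 1) (by omega)).neg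
  have h2 : IntegrableOn
      (fun t : ℝ => ((m : ℝ) + 1)⁻¹ * ((m + 1) * ((1 + t) ^ (m + 2))⁻¹)) (Ioi 0) :=
    h.const_mul _
  have h3 : ((m : ℝ) + 1) ≠ 0 := by positivity
  simpa [← mul_assoc, inv_mul_cancel₀ h3] using h2

theorem integral_inv_one_add_pow (n : ℕ) :
    ((n : ℝ) + 1) * ∫ t in Ioi (0 : ℝ), ((1 + t) ^ (n + 2))⁻¹ = 1 := by
  have h := integral_Ioi_of_hasDerivAt_of_tendsto'
    (fun t (ht : t ∈ Ici (0 : ℝ)) => hasDerivAt_neg_inv_one_add_pow n ht)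
    ((integrableOn_inv_one_add_pow (n + 2) (by omega)).const_mul _)
    (tendsto_inv_one_add_pow (n + 1) (by omega)).neg
  rw [integral_const_mul] at h
  simpa using h

theorem aestronglyMeasurable_P (n : ℕ) (hn : 1 ≤ n) (k : ℤ) :
    AEStronglyMeasurable (P n k) (volume.restrict (Ioi 0)) :=
  ((continuousOn_P n hn k).mono Ioi_subset_Ici_self).aestronglyMeasurable measurableSet_Ioi

theorem integrableOn_P (n : ℕ) (hn : 2 ≤ n) (k : ℤ) : IntegrableOn (P n k) (Ioi 0) := by
  obtain ⟨C, _, hC⟩ := exists_P_le n k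
  refine Integrable.mono' ((integrableOn_inv_one_add_pow n hn).const_mul C)
    (aestronglyMeasurable_P n (by omega) k) ?_
  filter_upwards [ae_restrict_mem measurableSet_Ioi] with t ht
  rw [Real.norm_of_nonneg (P_nonneg n k (le_of_lt ht))]
  exact hC t (le_of_lt ht)

theorem integrableOn_P_mul (n : ℕ) (hn : 2 ≤ n) (k : ℤ) {g : ℝ → ℝ} {M : ℝ}
    (hgm : AEStronglyMeasurable g (volume.restrict (Ioi 0)))
    (hg : ∀ t ∈ Ioi (0 : ℝ), |g t| ≤ M) : IntegrableOn (fun t => P n k t * g t) (Ioi 0) := by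
  refine Integrable.mul_bdd (c := M) (integrableOn_P n hn k) hgm ?_
  filter_upwards [ae_restrict_mem measurableSet_Ioi] with t ht using hg t ht

theorem P_zero_right (n k : ℕ) : P n (k : ℤ) 0 = if k = 0 then 1 else 0 := by
  rw [P_natCast]
  split_ifs with h
  · subst h; simp
  · simp [h]

theorem integral_P (n k : ℕ) : ((n : ℝ) + 1) * ∫ t in Ioi (0 : ℝ), P (n + 2) k t = 1 := by
  induction k with
  | zero =>
    refine Eq.trans (congrArg _ ?_) (integral_inv_one_add_pow n)
    refine integral_congr_ae (ae_of_all _ fun t => ?_)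
    have h := P_natCast (n + 2) 0 t
    simpa using h
  | succ k ih =>
    have hd := integral_Ioi_of_hasDerivAt_of_tendsto'
      (fun t (ht : t ∈ Ici (0 : ℝ)) => hasDerivAt_P (n + 1) (by omega) ((k + 1 : ℕ) : ℤ) ht)
      (((integrableOn_P (n + 2) (by omega) _).sub (integrableOn_P (n + 2) (by omega) _)).const_mul _)
      (tendsto_P_atTop (n + 1) (by omega) _)
    have e : (((k + 1 : ℕ) : ℤ) - 1) = (k : ℤ) := by push_cast; ring
    rw [integral_const_mul, integral_sub (integrableOn_P (n + 2) (by omega) _)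
      (integrableOn_P (n + 2) (by omega) _), P_zero_right, e] at hd
    have h0 : (((n + 1 : ℕ) : ℝ)) ≠ 0 := by positivity
    simp only [Nat.succ_ne_zero, if_false, sub_zero, mul_eq_zero, h0, false_or] at hd
    rwa [← sub_eq_zero.1 hd]

theorem v_zero (n : ℕ) (g : ℝ → ℝ) : v n 0 g = g 0 := by simp [v]

theorem v_succ (n k : ℕ) (g : ℝ → ℝ) :
    v n (k + 1) g = ((n : ℝ) + 1) * ∫ t in Ioi (0 : ℝ), P (n + 2) k t * g t := by
  simp [v]

theorem abs_v_le (n k : ℕ) {g : ℝ → ℝ} {M : ℝ} (hg : ∀ t ∈ Ici (0 : ℝ), |g t| ≤ M) :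
    |v n k g| ≤ M := by
  cases k with
  | zero => rw [v_zero]; exact hg 0 self_mem_Ici
  | succ k =>
    have h : ‖∫ t in Ioi (0 : ℝ), P (n + 2) k t * g t‖ ≤
        ∫ t in Ioi (0 : ℝ), P (n + 2) k t * M := by
      refine norm_integral_le_of_norm_le ((integrableOn_P (n + 2) (by omega) k).mul_const M) ?_
      filter_upwards [ae_restrict_mem measurableSet_Ioi] with t ht
      have hP := P_nonneg (n + 2) k (le_of_lt ht)
      rw [norm_mul, Real.norm_of_nonneg hP]
      exact mul_le_mul_of_nonneg_left (hg t (Ioi_subset_Ici_self ht)) hP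
    rw [integral_mul_const, Real.norm_eq_abs] at h
    rw [v_succ, abs_mul, abs_of_pos (by positivity : (0 : ℝ) < (n : ℝ) + 1)]
    calc ((n : ℝ) + 1) * |∫ t in Ioi (0 : ℝ), P (n + 2) k t * g t|
        ≤ ((n : ℝ) + 1) * ((∫ t in Ioi (0 : ℝ), P (n + 2) k t) * M) := by gcongr
      _ = M := by rw [← mul_assoc, integral_P, one_mul]

/-- Order elevation `v_{n+1,k} = ((n+k+1) v_{n,k} - k v_{n,k+1}) / (n+1)`. -/
theorem v_add_one (n k : ℕ) {g : ℝ → ℝ} {M : ℝ}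
    (hgm : AEStronglyMeasurable g (volume.restrict (Ioi 0)))
    (hg : ∀ t ∈ Ioi (0 : ℝ), |g t| ≤ M) :
    ((n : ℝ) + 1) * v (n + 1) k g = (n + k + 1) * v n k g - k * v n (k + 1) g := by
  cases k with
  | zero => simp [v_zero]
  | succ k =>
    rw [v_succ, v_succ, v_succ]
    have h1 := integrableOn_P_mul (n + 2) (by omega) k hgm hg
    have h2 := integrableOn_P_mul (n + 2) (by omega) (k + 1 : ℕ) hgm hg
    have h : ((n : ℝ) + 2) * ∫ t in Ioi (0 : ℝ), P (n + 1 + 2) k t * g t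
        = ∫ t in Ioi (0 : ℝ), ((n + 2 + k) * (P (n + 2) k t * g t)
          - (k + 1) * (P (n + 2) (k + 1 : ℕ) t * g t)) := by
      rw [← integral_const_mul]
      refine setIntegral_congr_fun measurableSet_Ioi fun t ht => ?_
      have e1 := add_mul_P_eq (n + 2) (by omega) k (le_of_lt ht)
      have e2 := mul_P_eq (n + 2) (by omega) (k + 1 : ℕ) t
      have e : (((k + 1 : ℕ) : ℤ) - 1) = (k : ℤ) := by push_cast; ring
      rw [e] at e2
      push_cast at e1 e2 ⊢
      have e3 : n + 1 + 2 = n + 2 + 1 := by ring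
      rw [e3]
      linear_combination g t * (e2 - e1)
    rw [integral_sub (h1.const_mul _) (h2.const_mul _), integral_const_mul,
      integral_const_mul] at h
    push_cast at h ⊢
    linear_combination ((n : ℝ) + 1) * h

theorem hasSum_P (n : ℕ) (hn : 1 ≤ n) {x : ℝ} (hx : 0 ≤ x) :
    HasSum (fun k : ℕ => P n k x) 1 := by
  obtain ⟨m, rfl⟩ := Nat.exists_eq_add_of_le' hn
  have h1 : (1 + x) ≠ 0 := by positivity
  have hr : ‖x / (1 + x)‖ < 1 := by
    rw [Real.norm_of_nonneg (by positivity), div_lt_one (by positivity)]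
    linarith
  have h := (hasSum_choose_mul_geometric_of_norm_lt_one' m hr).mul_left (((1 + x) ^ (m + 1))⁻¹)
  have e : (1 - x / (1 + x)) = (1 + x)⁻¹ := by field_simp; ring
  rw [e, Ring.inverse_eq_inv, inv_inv, inv_mul_cancel₀ (pow_ne_zero _ h1)] at h
  refine h.congr_fun ?_
  intro k
  have e1 : m + 1 + k - 1 = k + m := by omega
  rw [P_natCast, e1, Nat.choose_symm_add, div_pow, pow_add (1 + x) (m + 1) k]
  field_simp

theorem hasSum_mul_P (n : ℕ) (hn : 1 ≤ n) {x : ℝ} (hx : 0 ≤ x) :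
    HasSum (fun k : ℕ => (k : ℝ) * P n k x) (n * x) := by
  rw [← hasSum_nat_add_iff' 1]
  have h := (hasSum_P (n + 1) (by omega) hx).mul_left (n * x)
  simp only [Finset.sum_range_one, Nat.cast_zero, zero_mul, sub_zero]
  rw [mul_one] at h
  refine h.congr_fun ?_
  intro k
  have h2 := mul_P_eq n hn (k + 1 : ℕ) x
  have e : (((k + 1 : ℕ) : ℤ) - 1) = (k : ℤ) := by push_cast; ring
  rw [e, Int.cast_natCast] at h2
  exact h2

theorem hasSum_mul_sub_one_mul_P (n : ℕ) (hn : 1 ≤ n) {x : ℝ} (hx : 0 ≤ x) :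
    HasSum (fun k : ℕ => (k : ℝ) * (k - 1) * P n k x) (n * (n + 1) * x ^ 2) := by
  rw [← hasSum_nat_add_iff' 1]
  have h := (hasSum_mul_P (n + 1) (by omega) hx).mul_left (n * x)
  simp only [Finset.sum_range_one, Nat.cast_zero, zero_mul, sub_zero]
  have e0 : (n : ℝ) * x * ((n + 1 : ℕ) * x) = n * (n + 1) * x ^ 2 := by push_cast; ring
  rw [e0] at h
  refine h.congr_fun ?_
  intro k
  have h2 := mul_P_eq n hn (k + 1 : ℕ) x
  have e : (((k + 1 : ℕ) : ℤ) - 1) = (k : ℤ) := by push_cast; ring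
  rw [e, Int.cast_natCast] at h2
  push_cast at h2 ⊢
  linear_combination (k : ℝ) * h2

theorem summable_quadratic_mul_P (n : ℕ) (hn : 1 ≤ n) {x : ℝ} (hx : 0 ≤ x) :
    Summable (fun k : ℕ => (k : ℝ) * (n + k) * P n k x) := by
  have h := (hasSum_mul_sub_one_mul_P n hn hx).add ((hasSum_mul_P n hn hx).mul_left ((n : ℝ) + 1))
  refine h.summable.congr fun k => ?_
  ring

theorem Summable.bdd_mul_of_nonneg {a q : ℕ → ℝ} {M : ℝ} (ha : ∀ k, |a k| ≤ M)
    (hq0 : ∀ k, 0 ≤ q k) (hq : Summable q) : Summable (fun k => a k * q k) := by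
  refine Summable.of_norm_bounded (hq.mul_left M) fun k => ?_
  rw [norm_mul, Real.norm_of_nonneg (hq0 k)]
  exact mul_le_mul_of_nonneg_right (ha k) (hq0 k)

theorem tsum_pred_mul {a q : ℕ → ℝ} {M : ℝ} (ha : ∀ k, |a k| ≤ M)
    (hq0 : ∀ k, 0 ≤ q k) (hq : Summable q) (h0 : q 0 = 0) :
    ∑' k, a (k - 1) * q k = ∑' k, a k * q (k + 1) := by
  rw [(Summable.bdd_mul_of_nonneg (fun k => ha (k - 1)) hq0 hq).tsum_eq_zero_add]
  simp [h0]

theorem abs_tsum_mul_P_le (n : ℕ) (hn : 1 ≤ n) {x : ℝ} (hx : 0 ≤ x) {a : ℕ → ℝ} {M : ℝ}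
    (ha : ∀ k, |a k| ≤ M) : |∑' k : ℕ, a k * P n k x| ≤ M := by
  have h := tsum_of_norm_bounded ((hasSum_P n hn hx).mul_left M)
    (f := fun k : ℕ => a k * P n k x) fun k => by
      rw [norm_mul, Real.norm_of_nonneg (P_nonneg n k hx)]
      exact mul_le_mul_of_nonneg_right (ha k) (P_nonneg n k hx)
  simpa using h

theorem summable_mul_P (n : ℕ) (hn : 1 ≤ n) {x : ℝ} (hx : 0 ≤ x) {a : ℕ → ℝ} {M : ℝ}
    (ha : ∀ k, |a k| ≤ M) : Summable (fun k : ℕ => a k * P n k x) :=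
  Summable.bdd_mul_of_nonneg ha (fun k => P_nonneg n k hx) (hasSum_P n hn hx).summable

/-- The second difference weighted by the eigenvalue-type factor `k (n + k)`; the truncated
predecessor at `k = 0` is multiplied by zero. -/
noncomputable def weightedDiff (n : ℕ) (a : ℕ → ℝ) (k : ℕ) : ℝ :=
  (k : ℝ) * (n + k) * (a (k - 1) - 2 * a k + a (k + 1))

theorem hasSum_mul_Dt_P (n : ℕ) (hn : 1 ≤ n) {x : ℝ} (hx : 0 ≤ x) {a : ℕ → ℝ} {M : ℝ}
    (ha : ∀ k, |a k| ≤ M) :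
    HasSum (fun k : ℕ => a k * Dt (P n k) x) (∑' k : ℕ, weightedDiff n a k * P n k x) := by
  set q : ℕ → ℝ := fun k => (k : ℝ) * (n + k) * P n k x with hq
  have hq0 : ∀ k, 0 ≤ q k := fun k => by
    have := P_nonneg n k hx
    positivity
  have hqs : Summable q := summable_quadratic_mul_P n hn hx
  have hz : q 0 = 0 := by simp [hq]
  have hqs1 : Summable (fun k => q (k + 1)) := (summable_nat_add_iff 1).2 hqs
  set r : ℕ → ℝ := fun k => q (k - 1) with hr
  have hr1 : ∀ k, r (k + 1) = q k := fun k => by simp [hr]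
  have hr0 : r 0 = 0 := by simp [hr, hz]
  have hrs : Summable r := (summable_nat_add_iff 1).1 (by simpa only [hr1] using hqs)
  have s1 : Summable fun k => a k * r k :=
    Summable.bdd_mul_of_nonneg ha (fun k => hq0 (k - 1)) hrs
  have s2 := Summable.bdd_mul_of_nonneg ha hq0 hqs
  have s3 := Summable.bdd_mul_of_nonneg ha (fun k => hq0 (k + 1)) hqs1
  have s4 := Summable.bdd_mul_of_nonneg (fun k => ha (k - 1)) hq0 hqs
  have s5 := Summable.bdd_mul_of_nonneg (fun k => ha (k + 1)) hq0 hqs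
  have t1 : ∑' k, a (k - 1) * q k = ∑' k, a k * q (k + 1) := tsum_pred_mul ha hq0 hqs hz
  have t2 : ∑' k, a k * r k = ∑' k, a (k + 1) * q k := by
    rw [s1.tsum_eq_zero_add]
    simp only [hr0, hr1, mul_zero, zero_add]
  have hR : ∑' k : ℕ, weightedDiff n a k * P n k x
      = ∑' k, a k * r k - 2 * ∑' k, a k * q k + ∑' k, a k * q (k + 1) := by
    rw [t2, ← t1, ← tsum_mul_left, ← s5.tsum_sub (s2.mul_left 2), ←
      (s5.sub (s2.mul_left 2)).tsum_add s4]
    refine tsum_congr fun k => ?_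
    simp only [weightedDiff, hq]
    ring
  rw [hR]
  refine ((s1.hasSum.sub (s2.hasSum.mul_left 2)).add s3.hasSum).congr_fun ?_
  intro k
  rw [Dt_P n hn k hx]
  cases k with
  | zero => simp [hr0, hq, P_of_neg]
  | succ k =>
    rw [hr1]
    have e : (((k + 1 : ℕ) : ℤ) - 1) = (k : ℤ) := by push_cast; ring
    have e' : (((k + 1 : ℕ) : ℤ) + 1) = ((k + 1 + 1 : ℕ) : ℤ) := by push_cast; ring
    simp only [hq, e, e']
    push_cast
    ring

theorem tsum_mul_P_add_one (n : ℕ) (hn : 1 ≤ n) {x : ℝ} (hx : 0 ≤ x) {b : ℕ → ℝ} {M : ℝ}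
    (hb : ∀ k, |b k| ≤ M) :
    (n : ℝ) * ∑' k : ℕ, b k * P (n + 1) k x
      = ∑' k : ℕ, ((n + k) * b k - k * b (k - 1)) * P n k x := by
  set q : ℕ → ℝ := fun k => (k : ℝ) * P n k x with hq
  have hq0 : ∀ k, 0 ≤ q k := fun k => by
    have := P_nonneg n k hx
    positivity
  have hqs : Summable q := (hasSum_mul_P n hn hx).summable
  have hz : q 0 = 0 := by simp [hq]
  have s1 := Summable.bdd_mul_of_nonneg hb hq0 hqs
  have s2 := (summable_mul_P n hn hx hb).mul_left (n : ℝ)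
  have s3 := Summable.bdd_mul_of_nonneg (fun k => hb (k - 1)) hq0 hqs
  have s4 := Summable.bdd_mul_of_nonneg hb (fun k => hq0 (k + 1)) ((summable_nat_add_iff 1).2 hqs)
  have t : ∑' k, b (k - 1) * q k = ∑' k, b k * q (k + 1) := tsum_pred_mul hb hq0 hqs hz
  have hR : ∑' k : ℕ, ((n + k) * b k - k * b (k - 1)) * P n k x
      = ∑' k : ℕ, (n : ℝ) * (b k * P n k x) + ∑' k, b k * q k - ∑' k, b (k - 1) * q k := by
    rw [← s2.tsum_add s1, ← (s2.add s1).tsum_sub s3]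
    refine tsum_congr fun k => ?_
    simp only [hq]
    ring
  rw [hR, t, ← s2.tsum_add s1, ← (s2.add s1).tsum_sub s4, ← tsum_mul_left]
  refine tsum_congr fun k => ?_
  have h1 := add_mul_P_eq n hn k hx
  have h2 := mul_P_eq n hn (k + 1 : ℕ) x
  have e : (((k + 1 : ℕ) : ℤ) - 1) = (k : ℤ) := by push_cast; ring
  rw [e] at h2
  simp only [hq]
  push_cast at h1 h2 ⊢
  linear_combination b k * (h2 - h1)

/-- `V_n g - V_{n+1} g` in terms of the weighted second differences of `v_{n,k}(g)`. -/
theorem V_sub_V_add_one (n : ℕ) (hn : 1 ≤ n) {x : ℝ} (hx : 0 ≤ x) {g : ℝ → ℝ} {M : ℝ}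
    (hgm : AEStronglyMeasurable g (volume.restrict (Ioi 0)))
    (hg : ∀ t ∈ Ici (0 : ℝ), |g t| ≤ M)
    (hs : Summable fun k : ℕ => weightedDiff n (fun j => v n j g) k * P n k x) :
    V n g x - V (n + 1) g x
      = 1 / (n * (n + 1)) * ∑' k : ℕ, weightedDiff n (fun j => v n j g) k * P n k x := by
  have hn0 : (n : ℝ) ≠ 0 := by positivity
  have h1 := tsum_mul_P_add_one n hn hx (fun k => abs_v_le (n + 1) k hg)
  have sa := summable_mul_P n hn hx (fun k => abs_v_le n k hg)
  have h2 : ((n : ℝ) * (n + 1)) * V (n + 1) g x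
      = (n * (n + 1)) * V n g x
        - ∑' k : ℕ, weightedDiff n (fun j => v n j g) k * P n k x := by
    rw [V, V, mul_comm (n : ℝ), mul_assoc, h1, ← tsum_mul_left, ← tsum_mul_left,
      ← (sa.mul_left _).tsum_sub hs]
    refine tsum_congr fun k => ?_
    have hv := fun k => v_add_one n k hgm (fun t ht => hg t (Ioi_subset_Ici_self ht))
    have e1 := hv k
    cases k with
    | zero =>
      simp only [weightedDiff]
      push_cast at e1 ⊢
      linear_combination (n : ℝ) * P n (0 : ℕ) x * e1
    | succ k =>
      have e2 := hv k
      simp only [weightedDiff, Nat.add_sub_cancel]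
      push_cast at e1 e2 ⊢
      linear_combination P n (k + 1) x * ((n + k + 1) * e1 - (k + 1) * e2)
  field_simp
  linear_combination -h2

theorem integral_Ioi_eq_sub_of_tendsto {F F' : ℝ → ℝ} {l m : ℝ}
    (hderiv : ∀ t ∈ Ioi (0 : ℝ), HasDerivAt F (F' t) t) (hintegrable : IntegrableOn F' (Ioi 0))
    (h0 : Tendsto F (nhdsWithin 0 (Ioi 0)) (nhds l)) (hinf : Tendsto F atTop (nhds m)) :
    ∫ t in Ioi (0 : ℝ), F' t = m - l := by
  have hev : ∀ t ∈ Ioi (0 : ℝ), Function.update F 0 l =ᶠ[nhds t] F := fun t ht => by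
    filter_upwards [Ioi_mem_nhds ht] with s hs
    exact Function.update_of_ne (ne_of_gt hs) _ _
  have h := integral_Ioi_of_hasDerivAt_of_tendsto (f := Function.update F 0 l) (a := 0) (m := m)
    (f' := F') (by rwa [continuousWithinAt_update_same, Ici_sdiff_left])
    (fun t ht => (hderiv t ht).congr_of_eventuallyEq (hev t ht)) hintegrable
    (hinf.congr' (by
      filter_upwards [eventually_gt_atTop 0] with s hs
      exact (Function.update_of_ne (ne_of_gt hs) _ _).symm))
  simpa using h

theorem MemW2.hasDerivAt {g : ℝ → ℝ} (hg : MemW2 g) {t : ℝ} (ht : 0 < t) :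
    HasDerivAt g (deriv g t) t :=
  (hg.1.differentiableAt (Ioi_mem_nhds ht)).hasDerivAt

theorem MemW2.hasDerivAt_deriv {g : ℝ → ℝ} (hg : MemW2 g) {t : ℝ} (ht : 0 < t) :
    HasDerivAt (deriv g) (deriv (deriv g) t) t :=
  (hg.2.1.differentiableAt (Ioi_mem_nhds ht)).hasDerivAt

theorem Dt_zero (g : ℝ → ℝ) : Dt g 0 = 0 := by simp [Dt, psi]

theorem measurable_Dt (g : ℝ → ℝ) : Measurable (Dt g) := by
  have h : Measurable psi := by unfold psi; fun_prop
  exact h.mul (measurable_deriv _)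

theorem MemW2.exists_abs_Dt_le {g : ℝ → ℝ} (hg : MemW2 g) :
    ∃ M, 0 ≤ M ∧ ∀ t ∈ Ici (0 : ℝ), |Dt g t| ≤ M := by
  obtain ⟨M, hM⟩ := hg.2.2
  refine ⟨max M 0, le_max_right _ _, fun t ht => ?_⟩
  rcases (mem_Ici.1 ht).eq_or_lt with rfl | ht
  · simp [Dt_zero]
  · exact (hM t ht).trans (le_max_left _ _)

/-- Functions in `W²(ψ)` have at most logarithmically growing derivative. -/
theorem MemW2.exists_abs_deriv_le {g : ℝ → ℝ} (hg : MemW2 g) :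
    ∃ A B, 0 ≤ A ∧ 0 ≤ B ∧ ∀ t, 0 < t → |deriv g t| ≤ A + B * |Real.log t| := by
  obtain ⟨M, hM0, hM⟩ := hg.exists_abs_Dt_le
  have hd2 : ∀ t, 0 < t → |deriv (deriv g) t| ≤ M * t⁻¹ := fun t ht => by
    have h := hM t ht.le
    have hp : 0 < psi t := by unfold psi; positivity
    rw [Dt, abs_mul, abs_of_pos hp] at h
    have h1 : t * |deriv (deriv g) t| ≤ psi t * |deriv (deriv g) t| := by
      gcongr
      unfold psi
      nlinarith
    rw [← div_eq_mul_inv, le_div_iff₀ ht]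
    linarith
  have hder : ∀ c : ℝ, ∀ t, 0 < t → HasDerivAt (fun t => deriv g t + c * Real.log t)
      (deriv (deriv g) t + c * t⁻¹) t := fun c t ht =>
    (hg.hasDerivAt_deriv ht).add ((Real.hasDerivAt_log ht.ne').const_mul c)
  have hmono : MonotoneOn (fun t => deriv g t + M * Real.log t) (Ioi 0) := by
    refine monotoneOn_of_deriv_nonneg (convex_Ioi 0)
      (fun t ht => (hder M t ht).continuousAt.continuousWithinAt) ?_ ?_
    · rw [interior_Ioi]
      exact fun t ht => (hder M t ht).differentiableAt.differentiableWithinAt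
    · rw [interior_Ioi]
      intro t ht
      rw [(hder M t ht).deriv]
      linarith [(abs_le.1 (hd2 t ht)).1]
  have hanti : AntitoneOn (fun t => deriv g t + (-M) * Real.log t) (Ioi 0) := by
    refine antitoneOn_of_deriv_nonpos (convex_Ioi 0)
      (fun t ht => (hder (-M) t ht).continuousAt.continuousWithinAt) ?_ ?_
    · rw [interior_Ioi]
      exact fun t ht => (hder (-M) t ht).differentiableAt.differentiableWithinAt
    · rw [interior_Ioi]
      intro t ht
      rw [(hder (-M) t ht).deriv]
      linarith [(abs_le.1 (hd2 t ht)).2]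
  refine ⟨|deriv g 1|, M, abs_nonneg _, hM0, fun t ht => ?_⟩
  have h1 : (1 : ℝ) ∈ Ioi (0 : ℝ) := zero_lt_one' ℝ
  have ht' : t ∈ Ioi (0 : ℝ) := ht
  have a1 := le_abs_self (deriv g 1)
  have a2 := neg_abs_le (deriv g 1)
  rcases le_total t 1 with h | h
  · have b1 := hmono ht' h1 h
    have b2 := hanti ht' h1 h
    simp only [Real.log_one, mul_zero, add_zero] at b1 b2
    rw [abs_of_nonpos (Real.log_nonpos ht.le h), abs_le]
    constructor <;> linarith
  · have b1 := hmono h1 ht' h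
    have b2 := hanti h1 ht' h
    simp only [Real.log_one, mul_zero, add_zero] at b1 b2
    rw [abs_of_nonneg (Real.log_nonneg h), abs_le]
    constructor <;> linarith

theorem exists_P_succ_le (n : ℕ) (hn : 1 ≤ n) (k : ℕ) :
    ∃ C, 0 ≤ C ∧ ∀ t, 0 ≤ t → P n (k + 1 : ℕ) t ≤ C * (t * ((1 + t) ^ 2)⁻¹) := by
  obtain ⟨C, hC0, hC⟩ := exists_P_le (n + 1) k
  refine ⟨n * C, by positivity, fun t ht => ?_⟩
  have h := mul_P_eq n hn (k + 1 : ℕ) t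
  have e : (((k + 1 : ℕ) : ℤ) - 1) = (k : ℤ) := by push_cast; ring
  rw [e, Int.cast_natCast] at h
  have h1 : P n (k + 1 : ℕ) t ≤ ((k + 1 : ℕ) : ℝ) * P n (k + 1 : ℕ) t := by
    refine le_mul_of_one_le_left (P_nonneg n _ ht) ?_
    exact_mod_cast Nat.succ_le_succ (Nat.zero_le k)
  have h2 : ((1 + t) ^ (n + 1))⁻¹ ≤ ((1 + t) ^ 2)⁻¹ := by
    gcongr
    · linarith
    · omega
  calc P n (k + 1 : ℕ) t ≤ n * t * P (n + 1) k t := h1.trans h.le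
    _ ≤ n * t * (C * ((1 + t) ^ 2)⁻¹) := by
        gcongr
        exact (hC t ht).trans (by gcongr)
    _ = n * C * (t * ((1 + t) ^ 2)⁻¹) := by ring

theorem MemW2.tendsto_P_mul_deriv {g : ℝ → ℝ} (hg : MemW2 g) (n : ℕ) (hn : 1 ≤ n) (k : ℕ) :
    Tendsto (fun t => P n (k + 1 : ℕ) t * deriv g t) (nhdsWithin 0 (Ioi 0)) (nhds 0) ∧
      Tendsto (fun t => P n (k + 1 : ℕ) t * deriv g t) atTop (nhds 0) := by
  obtain ⟨A, B, hA, hB, hAB⟩ := hg.exists_abs_deriv_le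
  obtain ⟨C, hC0, hC⟩ := exists_P_succ_le n hn k
  have key : ∀ t, 0 < t → ‖P n (k + 1 : ℕ) t * deriv g t‖ ≤
      C * ((t * ((1 + t) ^ 2)⁻¹) * (A + B * |Real.log t|)) := fun t ht => by
    rw [norm_mul, Real.norm_of_nonneg (P_nonneg n _ ht.le), ← mul_assoc]
    have := hAB t ht
    rw [← Real.norm_eq_abs] at this
    gcongr
    exact hC t ht.le
  constructor
  · have l1 : Tendsto (fun t : ℝ => C * (t * A + B * |Real.log t * t|)) (nhdsWithin 0 (Ioi 0))
        (nhds 0) := by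
      have h1 : Tendsto (fun t : ℝ => t) (nhdsWithin 0 (Ioi 0)) (nhds 0) :=
        tendsto_nhdsWithin_of_tendsto_nhds tendsto_id
      have h2 := tendsto_log_mul_rpow_nhdsGT_zero one_pos
      simp only [Real.rpow_one] at h2
      simpa using ((h1.mul_const A).add (h2.abs.const_mul B)).const_mul C
    refine squeeze_zero_norm' ?_ l1
    filter_upwards [self_mem_nhdsWithin] with t ht
    have ht : (0 : ℝ) < t := ht
    refine (key t ht).trans ?_
    have h3 : ((1 + t) ^ 2)⁻¹ ≤ 1 := inv_le_one_of_one_le₀ (one_le_pow₀ (by linarith))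
    rw [abs_mul, abs_of_pos ht]
    calc C * (t * ((1 + t) ^ 2)⁻¹ * (A + B * |Real.log t|))
        ≤ C * (t * 1 * (A + B * |Real.log t|)) := by gcongr
      _ = C * (t * A + B * (|Real.log t| * t)) := by ring
  · have l1 : Tendsto (fun t : ℝ => C * (t⁻¹ * A + B * |Real.log t / t|)) atTop (nhds 0) := by
      have h2 : Tendsto (fun t : ℝ => Real.log t / t) atTop (nhds 0) :=
        Real.isLittleO_log_id_atTop.tendsto_div_nhds_zero
      simpa using ((tendsto_inv_atTop_zero.mul_const A).add (h2.abs.const_mul B)).const_mul C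
    refine squeeze_zero_norm' ?_ l1
    filter_upwards [eventually_gt_atTop 0] with t ht
    refine (key t ht).trans ?_
    have h3 : t * ((1 + t) ^ 2)⁻¹ ≤ t⁻¹ := by
      rw [← div_eq_mul_inv, div_le_iff₀ (by positivity), inv_mul_eq_div, le_div_iff₀ ht]
      nlinarith
    rw [abs_div, abs_of_pos ht]
    calc C * (t * ((1 + t) ^ 2)⁻¹ * (A + B * |Real.log t|))
        ≤ C * (t⁻¹ * (A + B * |Real.log t|)) := by gcongr
      _ = C * (t⁻¹ * A + B * (|Real.log t| / t)) := by ring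

theorem BddContOn.aestronglyMeasurable {g : ℝ → ℝ} (hg : BddContOn g) :
    AEStronglyMeasurable g (volume.restrict (Ioi 0)) :=
  (hg.1.mono Ioi_subset_Ici_self).aestronglyMeasurable measurableSet_Ioi

/-- The functionals `v_{n,k}` turn `D̃` into a weighted second difference. -/
theorem v_Dt (n : ℕ) (hn : 1 ≤ n) {g : ℝ → ℝ} (hg : BddContOn g) (hgW : MemW2 g) (k : ℕ) :
    v n k (Dt g) = weightedDiff n (fun j => v n j g) k := by
  cases k with
  | zero => simp [v_zero, Dt_zero, weightedDiff]
  | succ k =>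
  obtain ⟨M, hM⟩ := hg.2
  obtain ⟨M', -, hM'⟩ := hgW.exists_abs_Dt_le
  have hn0 : (n : ℝ) ≠ 0 := by positivity
  have e1 : (((k + 1 : ℕ) : ℤ) - 1) = (k : ℤ) := by push_cast; ring
  have e2 : (((k + 1 : ℕ) : ℤ) - 2) = (k : ℤ) - 1 := by push_cast; ring
  have hI : ∀ j : ℤ, IntegrableOn (fun t => P (n + 2) j t * g t) (Ioi 0) := fun j =>
    integrableOn_P_mul (n + 2) (by omega) j hg.aestronglyMeasurable
      (fun t ht => hM t (Ioi_subset_Ici_self ht))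
  have hD : IntegrableOn (fun t => P (n + 2) k t * Dt g t) (Ioi 0) :=
    integrableOn_P_mul (n + 2) (by omega) k (measurable_Dt g).aestronglyMeasurable
      (fun t ht => hM' t (Ioi_subset_Ici_self ht))
  set c : ℝ := ((k : ℝ) + 1) * (n + k + 1) with hc
  have hc0 : c ≠ 0 := by positivity
  have hder : ∀ t ∈ Ioi (0 : ℝ), HasDerivAt
      (fun t => P n (k + 1 : ℕ) t * deriv g t
        - n * (P (n + 1) k t - P (n + 1) (k + 1 : ℕ) t) * g t)
      (n * (n + 1) / c * (P (n + 2) k t * Dt g t)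
        - n * (n + 1) * (P (n + 2) (k - 1) t * g t - 2 * (P (n + 2) k t * g t)
          + P (n + 2) (k + 1 : ℕ) t * g t)) t := fun t ht => by
    have ht0 : 0 ≤ t := le_of_lt ht
    have d1 := hasDerivAt_P n hn (k + 1 : ℕ) ht0
    have d2 := hasDerivAt_deriv_P n hn (k + 1 : ℕ) ht0
    have h3 := psi_mul_P n hn (k + 1 : ℕ) ht0
    rw [e1] at d1 d2 h3
    rw [e2] at d2
    refine ((d1.mul (hgW.hasDerivAt_deriv ht)).sub (d2.mul (hgW.hasDerivAt ht))).congr_deriv ?_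
    have h4 : n * (n + 1) / c * (P (n + 2) k t * Dt g t)
        = P n (k + 1 : ℕ) t * deriv (deriv g) t := by
      rw [Dt]
      field_simp
      push_cast at h3 ⊢
      rw [hc]
      linear_combination deriv (deriv g) t * h3
    rw [h4]
    ring
  have i1 : IntegrableOn (fun t => P (n + 2) (k - 1) t * g t - 2 * (P (n + 2) k t * g t))
      (Ioi 0) := (hI (k - 1)).sub ((hI k).const_mul 2)
  have i2 : IntegrableOn (fun t => P (n + 2) (k - 1) t * g t - 2 * (P (n + 2) k t * g t)
      + P (n + 2) (k + 1 : ℕ) t * g t) (Ioi 0) := i1.add (hI (k + 1 : ℕ))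
  have hintegrable := (hD.const_mul (n * (n + 1) / c)).sub (i2.const_mul (n * (n + 1)))
  obtain ⟨lim0, limInf⟩ := hgW.tendsto_P_mul_deriv n hn k
  have hcont : ContinuousWithinAt
      (fun t => n * (P (n + 1) k t - P (n + 1) (k + 1 : ℕ) t) * g t) (Ici 0) 0 := by
    have h1 := continuousOn_P (n + 1) (by omega) k 0 self_mem_Ici
    have h2 := continuousOn_P (n + 1) (by omega) (k + 1 : ℕ) 0 self_mem_Ici
    exact ((h1.sub h2).const_mul (n : ℝ)).mul (hg.1 0 self_mem_Ici)
  have l0 := lim0.sub (hcont.tendsto.mono_left (nhdsWithin_mono _ Ioi_subset_Ici_self))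
  have linf : Tendsto (fun t => n * (P (n + 1) k t - P (n + 1) (k + 1 : ℕ) t) * g t) atTop
      (nhds 0) := by
    have h1 := ((tendsto_P_atTop (n + 1) (by omega) k).sub
      (tendsto_P_atTop (n + 1) (by omega) (k + 1 : ℕ))).const_mul (n : ℝ)
    rw [sub_zero, mul_zero] at h1
    refine h1.zero_mul_isBoundedUnder_le ⟨M, ?_⟩
    rw [eventually_map]
    filter_upwards [eventually_ge_atTop 0] with t ht using hM t ht
  have h := integral_Ioi_eq_sub_of_tendsto hder hintegrable l0 (limInf.sub linf)
  rw [integral_sub (hD.const_mul _) (i2.const_mul _), integral_const_mul,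
    integral_const_mul, integral_add i1 (hI (k + 1 : ℕ)), integral_sub (hI (k - 1))
    ((hI k).const_mul 2), integral_const_mul, P_zero_right, P_zero_right] at h
  simp only [weightedDiff, Nat.add_sub_cancel, v_succ]
  have hk : v n k g = (if k = 0 then g 0 else 0)
      + ((n : ℝ) + 1) * ∫ t in Ioi (0 : ℝ), P (n + 2) (k - 1) t * g t := by
    cases k with
    | zero => simp [v_zero, P_of_neg]
    | succ j =>
      have e : (((j + 1 : ℕ) : ℤ) - 1) = (j : ℤ) := by push_cast; ring
      simp [v_succ]
  rw [hk]
  have hif : (n : ℝ) * ((if k = 0 then (1 : ℝ) else 0) - if k + 1 = 0 then 1 else 0) * g 0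
      = n * (if k = 0 then g 0 else 0) := by
    split_ifs <;> simp_all
  rw [hif] at h
  have hcast : ((k + 1 : ℕ) : ℝ) * (n + (k + 1 : ℕ)) = c := by rw [hc]; push_cast; ring
  rw [hcast]
  field_simp at h
  rw [← sub_eq_zero] at h ⊢
  refine (mul_right_injective₀ hn0) ?_
  simp only [mul_zero]
  linear_combination h

theorem id_mul_P (n k : ℕ) (hn : 1 ≤ n) (t : ℝ) :
    t * P (n + 1) k t = ((k : ℝ) + 1) / n * P n (k + 1 : ℕ) t := by
  have h := mul_P_eq n hn (k + 1 : ℕ) t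
  have e : (((k + 1 : ℕ) : ℤ) - 1) = (k : ℤ) := by push_cast; ring
  have hn0 : (n : ℝ) ≠ 0 := by positivity
  rw [e] at h
  field_simp
  push_cast at h ⊢
  linear_combination -h

theorem P_mul_sub_sq (n k : ℕ) (hn : 1 ≤ n) (x t : ℝ) :
    P (n + 2) k t * (t - x) ^ 2 = ((k : ℝ) + 1) * (k + 2) / (n * (n + 1)) * P n (k + 2 : ℕ) t
      - 2 * x * ((k + 1) / (n + 1)) * P (n + 1) (k + 1 : ℕ) t + x ^ 2 * P (n + 2) k t := by
  have h1 := id_mul_P (n + 1) k (by omega) t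
  have h2 : t * P (n + 1) (k + 1 : ℕ) t = (((k + 1 : ℕ) : ℝ) + 1) / n * P n (k + 2 : ℕ) t :=
    id_mul_P n (k + 1) hn t
  have hn0 : (n : ℝ) ≠ 0 := by positivity
  have h3 : t ^ 2 * P (n + 2) k t
      = ((k : ℝ) + 1) * (k + 2) / (n * (n + 1)) * P n (k + 2 : ℕ) t := by
    rw [pow_two, mul_assoc, h1, mul_left_comm, h2]
    generalize P n (k + 2 : ℕ) t = p
    push_cast
    field_simp
    ring
  push_cast at h1 h3 ⊢
  linear_combination h3 - 2 * x * h1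

theorem integrableOn_P_mul_sub_sq (n k : ℕ) (hn : 2 ≤ n) (x : ℝ) :
    IntegrableOn (fun t => P (n + 2) k t * (t - x) ^ 2) (Ioi 0) := by
  simp only [P_mul_sub_sq n k (by omega) x]
  exact (((integrableOn_P n hn _).const_mul _).sub
    ((integrableOn_P (n + 1) (by omega) _).const_mul _)).add
    ((integrableOn_P (n + 2) (by omega) _).const_mul _)

theorem v_sub_sq (n k : ℕ) (hn : 2 ≤ n) (x : ℝ) :
    v n k (fun t => (t - x) ^ 2)
      = (k : ℝ) * (k + 1) / (n * (n - 1)) - 2 * x * k / n + x ^ 2 := by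
  cases k with
  | zero => simp [v_zero]
  | succ k =>
    obtain ⟨m, rfl⟩ := Nat.exists_eq_add_of_le' hn
    have i1 : IntegrableOn (fun t => ((k : ℝ) + 1) * (k + 2) / ((m + 2 : ℕ) * ((m + 2 : ℕ) + 1))
        * P (m + 2) (k + 2 : ℕ) t) (Ioi 0) := (integrableOn_P (m + 2) hn _).const_mul _
    have i2 : IntegrableOn (fun t => 2 * x * (((k : ℝ) + 1) / ((m + 2 : ℕ) + 1))
        * P (m + 2 + 1) (k + 1 : ℕ) t) (Ioi 0) :=
      (integrableOn_P (m + 2 + 1) (by omega) _).const_mul _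
    have i3 : IntegrableOn (fun t => x ^ 2 * P (m + 2 + 2) k t) (Ioi 0) :=
      (integrableOn_P (m + 2 + 2) (by omega) _).const_mul _
    have i12 : IntegrableOn (fun t => ((k : ℝ) + 1) * (k + 2) / ((m + 2 : ℕ) * ((m + 2 : ℕ) + 1))
        * P (m + 2) (k + 2 : ℕ) t - 2 * x * (((k : ℝ) + 1) / ((m + 2 : ℕ) + 1))
        * P (m + 2 + 1) (k + 1 : ℕ) t) (Ioi 0) := i1.sub i2
    have j1 := integral_P m (k + 2)
    have j2 := integral_P (m + 1) (k + 1)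
    have j3 := integral_P (m + 2) k
    rw [v_succ]
    simp only [P_mul_sub_sq (m + 2) k (by omega) x]
    rw [integral_add i12 i3, integral_sub i1 i2, integral_const_mul, integral_const_mul,
      integral_const_mul]
    have e : m + 2 + 1 = m + 1 + 2 := by ring
    rw [e]
    have k1 := eq_div_of_mul_eq (by positivity) ((mul_comm _ _).trans j1)
    have k2 := eq_div_of_mul_eq (by positivity) ((mul_comm _ _).trans j2)
    have k3 := eq_div_of_mul_eq (by positivity) ((mul_comm _ _).trans j3)
    rw [k1, k2, k3]
    have e1 : ((m : ℝ) + 2 - 1) = m + 1 := by ring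
    have e2 : ((m : ℝ) + 1 + 1) = m + 2 := by ring
    push_cast
    rw [e1, e2]
    field_simp
    ring

theorem abs_v_sub_le (n k : ℕ) (hn : 2 ≤ n) {g : ℝ → ℝ} {x y ε C : ℝ} (hg : BddContOn g)
    (h : ∀ t ∈ Ici (0 : ℝ), |g t - y| ≤ ε + C * (t - x) ^ 2) :
    |v n k g - y| ≤ ε + C * v n k (fun t => (t - x) ^ 2) := by
  cases k with
  | zero => simpa [v_zero] using h 0 self_mem_Ici
  | succ k =>
    obtain ⟨M, hM⟩ := hg.2
    have i0 := integrableOn_P (n + 2) (by omega) k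
    have ig := integrableOn_P_mul (n + 2) (by omega) k hg.aestronglyMeasurable
      (fun t ht => hM t (Ioi_subset_Ici_self ht))
    have iq := integrableOn_P_mul_sub_sq n k hn x
    have j := integral_P n k
    have hn1 : (0 : ℝ) < n + 1 := by positivity
    have hle : ‖∫ t in Ioi (0 : ℝ), (P (n + 2) k t * g t - P (n + 2) k t * y)‖ ≤
        ∫ t in Ioi (0 : ℝ), (P (n + 2) k t * ε + C * (P (n + 2) k t * (t - x) ^ 2)) := by
      refine norm_integral_le_of_norm_le ((i0.mul_const ε).add (iq.const_mul C)) ?_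
      filter_upwards [ae_restrict_mem measurableSet_Ioi] with t ht
      have hP := P_nonneg (n + 2) k (le_of_lt ht)
      rw [← mul_sub, norm_mul, Real.norm_of_nonneg hP]
      calc P (n + 2) k t * ‖g t - y‖ ≤ P (n + 2) k t * (ε + C * (t - x) ^ 2) :=
            mul_le_mul_of_nonneg_left (h t (Ioi_subset_Ici_self ht)) hP
        _ = _ := by ring
    rw [integral_sub ig (i0.mul_const y), integral_add (i0.mul_const ε) (iq.const_mul C),
      integral_mul_const, integral_mul_const, integral_const_mul, Real.norm_eq_abs] at hle
    have hle' := mul_le_mul_of_nonneg_left hle hn1.le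
    rw [← abs_of_pos hn1, ← abs_mul, abs_of_pos hn1] at hle'
    rw [v_succ, v_succ]
    calc _ = |((n : ℝ) + 1) * ((∫ t in Ioi (0 : ℝ), P (n + 2) k t * g t)
          - (∫ t in Ioi (0 : ℝ), P (n + 2) k t) * y)| := by
            congr 1
            linear_combination y * j
      _ ≤ _ := hle'
      _ = _ := by linear_combination ε * j

theorem abs_V_sub_le (n : ℕ) (hn : 2 ≤ n) {g : ℝ → ℝ} {x ε C : ℝ} (hx : 0 ≤ x)
    (hg : BddContOn g) (h : ∀ t ∈ Ici (0 : ℝ), |g t - g x| ≤ ε + C * (t - x) ^ 2) :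
    |V n g x - g x| ≤ ε + C * (2 * psi x * ((n : ℝ) - 1)⁻¹) := by
  obtain ⟨M, hM⟩ := hg.2
  have h0 := hasSum_P n (by omega) hx
  have h1 := hasSum_mul_P n (by omega) hx
  have h2 := hasSum_mul_sub_one_mul_P n (by omega) hx
  have hs := ((summable_mul_P n (by omega) hx (fun k => abs_v_le n k hM)).hasSum).sub
    (h0.mul_left (g x))
  have hn1 : ((n : ℝ) - 1) ≠ 0 := by
    have : (2 : ℝ) ≤ n := by exact_mod_cast hn
    exact ne_of_gt (by linarith)
  have hn0 : (n : ℝ) ≠ 0 := by positivity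
  have hb : HasSum (fun k : ℕ => (ε + C * v n k (fun t => (t - x) ^ 2)) * P n k x)
      (ε + C * (2 * psi x * ((n : ℝ) - 1)⁻¹)) := by
    have := ((h2.mul_left (C / (n * (n - 1)))).add
      (h1.mul_left (C * (2 / (n * (n - 1)) - 2 * x / n)))).add (h0.mul_left (ε + C * x ^ 2))
    have e : C / (n * (n - 1)) * (n * (n + 1) * x ^ 2)
        + C * (2 / (n * (n - 1)) - 2 * x / n) * (n * x) + (ε + C * x ^ 2) * 1
        = ε + C * (2 * psi x * ((n : ℝ) - 1)⁻¹) := by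
      unfold psi
      field_simp
      ring
    rw [e] at this
    refine this.congr_fun ?_
    intro k
    rw [v_sub_sq n k hn x]
    field_simp
    ring
  rw [mul_one] at hs
  have hle := tsum_of_norm_bounded hb (f := fun k : ℕ => v n k g * P n k x - g x * P n k x)
    fun k => by
      rw [← sub_mul, norm_mul, Real.norm_of_nonneg (P_nonneg n k hx)]
      exact mul_le_mul_of_nonneg_right (abs_v_sub_le n k hn hg h) (P_nonneg n k hx)
  rw [hs.tsum_eq] at hle
  exact hle

theorem exists_abs_sub_le_add_sq {g : ℝ → ℝ} (hg : BddContOn g) {x : ℝ} (hx : 0 ≤ x) {ε : ℝ}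
    (hε : 0 < ε) : ∃ C, ∀ t ∈ Ici (0 : ℝ), |g t - g x| ≤ ε + C * (t - x) ^ 2 := by
  obtain ⟨M, hM⟩ := hg.2
  obtain ⟨δ, hδ, h⟩ := Metric.continuousWithinAt_iff.1 (hg.1 x hx) ε hε
  have hM0 : 0 ≤ M := (abs_nonneg _).trans (hM x hx)
  refine ⟨2 * M / δ ^ 2, fun t ht => ?_⟩
  rcases lt_or_ge (dist t x) δ with hd | hd
  · have h1 := h ht hd
    rw [Real.dist_eq] at h1
    have : 0 ≤ 2 * M / δ ^ 2 * (t - x) ^ 2 := by positivity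
    linarith
  · rw [Real.dist_eq] at hd
    have h1 : δ ^ 2 ≤ (t - x) ^ 2 := by
      rw [← sq_abs (t - x)]
      gcongr
    have h2 : 2 * M ≤ 2 * M / δ ^ 2 * (t - x) ^ 2 := by
      rw [div_mul_eq_mul_div, le_div_iff₀ (by positivity)]
      gcongr
    have h3 := abs_sub (g t) (g x)
    have h4 := hM t ht
    have h5 := hM x hx
    linarith

theorem tendsto_V {g : ℝ → ℝ} (hg : BddContOn g) {x : ℝ} (hx : 0 ≤ x) :
    Tendsto (fun n => V n g x) atTop (nhds (g x)) := by
  rw [Metric.tendsto_nhds]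
  intro ε hε
  obtain ⟨C, hC⟩ := exists_abs_sub_le_add_sq hg hx (half_pos hε)
  have hlim : Tendsto (fun n : ℕ => ε / 2 + C * (2 * psi x * ((n : ℝ) - 1)⁻¹)) atTop
      (nhds (ε / 2)) := by
    have h1 : Tendsto (fun n : ℕ => ((n : ℝ) - 1)⁻¹) atTop (nhds 0) :=
      (tendsto_atTop_add_const_right _ (-1) tendsto_natCast_atTop_atTop).inv_tendsto_atTop
    simpa using ((h1.const_mul (2 * psi x)).const_mul C).const_add (ε / 2)
  filter_upwards [hlim.eventually_lt_const (half_lt_self hε), eventually_ge_atTop 2] with n h1 h2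
  rw [Real.dist_eq]
  exact (abs_V_sub_le n h2 hx hg hC).trans_lt h1

theorem abs_V_le (n : ℕ) (hn : 1 ≤ n) {g : ℝ → ℝ} {M x : ℝ} (hx : 0 ≤ x)
    (hg : ∀ t ∈ Ici (0 : ℝ), |g t| ≤ M) : |V n g x| ≤ M :=
  abs_tsum_mul_P_le n hn hx fun k => abs_v_le n k hg

theorem V_Dt_eq (n : ℕ) (hn : 1 ≤ n) {g : ℝ → ℝ} (hg : BddContOn g) (hgW : MemW2 g) (x : ℝ) :
    V n (Dt g) x = ∑' k : ℕ, weightedDiff n (fun j => v n j g) k * P n k x :=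
  tsum_congr fun k => by rw [v_Dt n hn hg hgW]

theorem V_sub_V_add_one_eq_V_Dt (n : ℕ) (hn : 1 ≤ n) {g : ℝ → ℝ} (hg : BddContOn g)
    (hgW : MemW2 g) {x : ℝ} (hx : 0 ≤ x) :
    V n g x - V (n + 1) g x = 1 / (n * (n + 1)) * V n (Dt g) x := by
  obtain ⟨M, hM⟩ := hg.2
  obtain ⟨M', -, hM'⟩ := hgW.exists_abs_Dt_le
  rw [V_Dt_eq n hn hg hgW]
  refine V_sub_V_add_one n hn hx hg.aestronglyMeasurable hM ?_
  refine (summable_mul_P n hn hx (fun k => abs_v_le n k hM')).congr fun k => ?_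
  rw [v_Dt n hn hg hgW]

theorem Vt_eq (n : ℕ) (hn : 1 ≤ n) {g : ℝ → ℝ} (hg : BddContOn g) (hgW : MemW2 g) {x : ℝ}
    (hx : 0 ≤ x) : Vt n g x = V n g x - 1 / n * V n (Dt g) x := by
  obtain ⟨M, hM⟩ := hg.2
  have h1 := (summable_mul_P n hn hx (fun k => abs_v_le n k hM)).hasSum
  have h2 := hasSum_mul_Dt_P n hn hx (fun k => abs_v_le n k hM)
  rw [V_Dt_eq n hn hg hgW, V, Vt, ← (h1.sub (h2.mul_left (1 / (n : ℝ)))).tsum_eq]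
  exact tsum_congr fun k => by ring

theorem bddContOn_Dt {f : ℝ → ℝ} (hf : MemW20 f) (hDf : MemW2 (Dt f)) : BddContOn (Dt f) := by
  obtain ⟨M, -, hM⟩ := hf.1.exists_abs_Dt_le
  refine ⟨fun t ht => ?_, M, hM⟩
  rcases (mem_Ici.1 ht).eq_or_lt with rfl | ht
  · rw [← continuousWithinAt_Ioi_iff_Ici, ContinuousWithinAt, Dt_zero]
    exact hf.2
  · exact (hDf.hasDerivAt ht).continuousAt.continuousWithinAt

theorem Vt_sub_Vt_add_one (n : ℕ) (hn : 1 ≤ n) {f : ℝ → ℝ} (hf : BddContOn f) (hfW : MemW20 f)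
    (hDfW : MemW2 (Dt f)) {x : ℝ} (hx : 0 ≤ x) :
    Vt (n + 1) f x - Vt n f x = 1 / (n * ((n : ℝ) + 1) ^ 2) * V n (Dt (Dt f)) x := by
  have h1 := V_sub_V_add_one_eq_V_Dt n hn hf hfW.1 hx
  have h2 := V_sub_V_add_one_eq_V_Dt n hn (bddContOn_Dt hfW hDfW) hDfW hx
  have hn0 : (n : ℝ) ≠ 0 := by positivity
  rw [Vt_eq n hn hf hfW.1 hx, Vt_eq (n + 1) (by omega) hf hfW.1 hx]
  have e : 1 / (n * ((n : ℝ) + 1) ^ 2) * V n (Dt (Dt f)) x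
      = 1 / ((n : ℝ) + 1) * (1 / (n * (n + 1)) * V n (Dt (Dt f)) x) := by
    field_simp
  have e' : 1 / (n : ℝ) - 1 / (n * (n + 1)) = 1 / (n + 1) := by
    field_simp
    ring
  rw [e, ← h2]
  push_cast
  linear_combination -h1 + V n (Dt f) x * e'

theorem tendsto_Vt {f : ℝ → ℝ} (hf : BddContOn f) (hfW : MemW2 f) {x : ℝ} (hx : 0 ≤ x) :
    Tendsto (fun n => Vt n f x) atTop (nhds (f x)) := by
  obtain ⟨M, -, hM⟩ := hfW.exists_abs_Dt_le
  have h1 : Tendsto (fun n : ℕ => 1 / (n : ℝ) * V n (Dt f) x) atTop (nhds 0) := by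
    refine tendsto_one_div_atTop_nhds_zero_nat.zero_mul_isBoundedUnder_le ⟨M, ?_⟩
    rw [eventually_map]
    filter_upwards [eventually_ge_atTop 1] with n hn using abs_V_le n hn hx hM
  have h2 := (tendsto_V hf hx).sub h1
  rw [sub_zero] at h2
  refine h2.congr' ?_
  filter_upwards [eventually_ge_atTop 1] with n hn using (Vt_eq n hn hf hfW hx).symm

theorem Vt_sub_f_series (n : ℕ) (hn : 2 ≤ n) (f : ℝ → ℝ) (hf : BddContOn f)
    (hfW : MemW20 f) (hDfW : MemW2 (Dt f)) :
    ∀ x ∈ Set.Ici (0 : ℝ),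
      Vt n f x - f x
        = -∑' j : ℕ, (1 / (((n : ℝ) + (j : ℝ)) * ((n : ℝ) + (j : ℝ) + 1) ^ 2))
            * V (n + j) (Dt (Dt f)) x := by
  intro x hx
  obtain ⟨M, hM0, hM⟩ := hDfW.exists_abs_Dt_le
  set u : ℕ → ℝ := fun j => (1 / (((n : ℝ) + (j : ℝ)) * ((n : ℝ) + (j : ℝ) + 1) ^ 2))
    * V (n + j) (Dt (Dt f)) x with hu
  have hstep : ∀ j, u j = Vt (n + (j + 1)) f x - Vt (n + j) f x := fun j => by
    have h := Vt_sub_Vt_add_one (n + j) (by omega) hf hfW hDfW hx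
    rw [← add_assoc, h, hu]
    push_cast
    rfl
  have hsum : Summable u := by
    have hs : Summable fun j : ℕ => M * (1 / ((j + 1 : ℕ) : ℝ) ^ 2) :=
      ((summable_nat_add_iff 1).2 (Real.summable_one_div_nat_pow.2 one_lt_two)).mul_left M
    refine Summable.of_norm_bounded hs fun j => ?_
    have hn' : (1 : ℝ) ≤ n := by exact_mod_cast (by omega : 1 ≤ n)
    have hV := abs_V_le (n + j) (by omega) hx hM
    have hj : (0 : ℝ) ≤ j := Nat.cast_nonneg j
    rw [hu, norm_mul, Real.norm_of_nonneg (by positivity), Real.norm_eq_abs, mul_comm]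
    push_cast
    have hle : ((j : ℝ) + 1) ^ 2 ≤ ((n : ℝ) + j) * ((n : ℝ) + j + 1) ^ 2 := by
      have a1 : ((j : ℝ) + 1) ^ 2 ≤ ((n : ℝ) + j + 1) ^ 2 := by
        gcongr
        linarith
      exact a1.trans (le_mul_of_one_le_left (by positivity) (by linarith))
    gcongr
  have hpart : ∀ N, ∑ j ∈ Finset.range N, u j = Vt (n + N) f x - Vt n f x := fun N => by
    rw [Finset.sum_congr rfl fun j _ => hstep j]
    exact Finset.sum_range_sub (fun j => Vt (n + j) f x) N
  have hlim : Tendsto (fun N => ∑ j ∈ Finset.range N, u j) atTop (nhds (f x - Vt n f x)) := by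
    simp only [hpart]
    refine Tendsto.sub_const ?_ _
    have h := (tendsto_add_atTop_iff_nat n).2 (tendsto_Vt hf hfW.1 hx)
    simpa only [add_comm n] using h
  rw [tendsto_nhds_unique hsum.hasSum.tendsto_sum_nat hlim]
  ring
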